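/- Let (A,·,T) be a Rota-Baxter algebra of weight λ over a field k of characteristic 0 and (M,T_M) a Rota-Baxter bimodule over it. Then the operator ∂ is a differential: for every n ≥ 0 and every k-multilinear map f : A^n → M, ∂^{n+1}(∂ⁿ(f)) = 0. Thus (C•_RBO(A,M), ∂) is a cochain complex, the cochain complex of the Rota-Baxter operator T with coefficients in (M,T_M). -/

import Mathlib

/-- The coboundary `∂ⁿ` of the cochain complex of a Rota-Baxter operator `T` with
coefficients in a Rota-Baxter bimodule `(M, TM)`, on `n`-cochains viewed as functions
`(Fin n → A) → M` (0-indexed version of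
`∂ⁿ(f)(a₁,…,a_{n+1}) = (−1)^{n+1}(T(a₁) f(a₂,…) − T_M(a₁ f(a₂,…)))
 + Σ_{i=1}^{n} (−1)^{n−i+1}( f(…, a_i T(a_{i+1}),…) + f(…, T(a_i) a_{i+1},…)
   + λ f(…, a_i a_{i+1},…)) + (f(a₁,…,a_n) T(a_{n+1}) − T_M(f(a₁,…,a_n) a_{n+1}))`). -/
def rboCoboundary {k A M : Type*} [Field k] [NonUnitalRing A] [Module k A]
    [AddCommGroup M] [Module k M]
    (lsmul : A → M → M) (rsmul : M → A → M) (T : A → A) (TM : M → M) (lam : k)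
    (n : ℕ) (f : (Fin n → A) → M) : (Fin (n + 1) → A) → M := fun a =>
  ((-1 : ℤ) ^ (n + 1)) •
      (lsmul (T (a 0)) (f fun i => a i.succ) - TM (lsmul (a 0) (f fun i => a i.succ)))
    + (∑ i : Fin n, ((-1 : ℤ) ^ (n - (i : ℕ))) •
        (f (fun j =>
            if (j : ℕ) < (i : ℕ) then a j.castSucc
            else if (j : ℕ) = (i : ℕ) then a j.castSucc * T (a j.succ)
            else a j.succ)
          + f (fun j =>
            if (j : ℕ) < (i : ℕ) then a j.castSucc
            else if (j : ℕ) = (i : ℕ) then T (a j.castSucc) * a j.succ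
            else a j.succ)
          + lam • f (fun j =>
            if (j : ℕ) < (i : ℕ) then a j.castSucc
            else if (j : ℕ) = (i : ℕ) then a j.castSucc * a j.succ
            else a j.succ)))
    + (rsmul (f fun i => a i.castSucc) (T (a (Fin.last n)))
        - TM (rsmul (f fun i => a i.castSucc) (a (Fin.last n))))

open Finset

section AlternatingSum

/-- The alternating double sum of a family satisfying the cosimplicial identities vanishes. -/
theorem sum_sum_alternating_eq_zero {G : Type*} [AddCommGroup G] (F : ℕ → ℕ → G) (N : ℕ)
    (hF : ∀ i j, i ≤ j → j < N → F (j + 1) i = F i j) :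
    ∑ j ∈ range (N + 1), ∑ i ∈ range N, ((-1 : ℤ) ^ (j + i)) • F j i = 0 := by
  induction N with
  | zero => simp
  | succ N ih =>
    have hsplit : ∑ j ∈ range (N + 1), ∑ i ∈ range (N + 1), ((-1 : ℤ) ^ (j + i)) • F j i =
        ∑ j ∈ range (N + 1), ∑ i ∈ range N, ((-1 : ℤ) ^ (j + i)) • F j i +
          ∑ j ∈ range (N + 1), ((-1 : ℤ) ^ (j + N)) • F j N := by
      rw [← sum_add_distrib]
      exact sum_congr rfl fun j _ => sum_range_succ _ N
    rw [sum_range_succ, hsplit, ih fun i j hij hj => hF i j hij (by omega), zero_add,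
      ← sum_add_distrib]
    refine sum_eq_zero fun i hi => ?_
    rw [hF i N (by simpa [Nat.lt_succ_iff] using hi) (by omega), ← add_smul]
    have : (-1 : ℤ) ^ (i + N) + (-1) ^ (N + 1 + i) = 0 := by ring
    rw [this, zero_smul]

end AlternatingSum

section Hochschild

variable {k A M : Type*} [CommRing k] [AddCommGroup A] [Module k A] [AddCommGroup M] [Module k M]

/-- The `i`-th coface map on Hochschild cochains of a (nonunital) algebra with product `μ`, with
coefficients in a bimodule with left action `L` and right action `R`. -/
def hochschildFace (μ : A →ₗ[k] A →ₗ[k] A) (L R : A →ₗ[k] M →ₗ[k] M) (n i : ℕ)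
    (f : (Fin n → A) → M) : (Fin (n + 1) → A) → M := fun a =>
  if i = 0 then L (a 0) (f fun p => a p.succ)
  else if i ≤ n then
    f fun p =>
      if (p : ℕ) + 1 < i then a p.castSucc
      else if (p : ℕ) + 1 = i then μ (a p.castSucc) (a p.succ)
      else a p.succ
  else R (a (Fin.last n)) (f fun p => a p.castSucc)

/-- The Hochschild coboundary, normalised so that the last face has sign `1`. -/
def hochschildCoboundary (μ : A →ₗ[k] A →ₗ[k] A) (L R : A →ₗ[k] M →ₗ[k] M) (n : ℕ)
    (f : (Fin n → A) → M) : (Fin (n + 1) → A) → M := fun a =>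
  ((-1 : ℤ) ^ (n + 1)) •
    ∑ i ∈ range (n + 2), ((-1 : ℤ) ^ i) • hochschildFace μ L R n i f a

variable (μ : A →ₗ[k] A →ₗ[k] A) (L R : A →ₗ[k] M →ₗ[k] M)

theorem exists_nat_extension {n : ℕ} (a : Fin n → A) : ∃ b : ℕ → A, a = fun p : Fin n => b p :=
  ⟨fun i => if h : i < n then a ⟨i, h⟩ else 0, by ext p; simp⟩

theorem hochschildFace_hochschildFace
    (hμ : ∀ a b c, μ (μ a b) c = μ a (μ b c))
    (hL : ∀ a b m, L (μ a b) m = L a (L b m))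
    (hR : ∀ a b m, R (μ a b) m = R b (R a m))
    (hLR : ∀ a b m, R b (L a m) = L a (R b m))
    (n i j : ℕ) (hij : i ≤ j) (hj : j < n + 2) (f : (Fin n → A) → M) :
    hochschildFace μ L R (n + 1) (j + 1) (hochschildFace μ L R n i f) =
      hochschildFace μ L R (n + 1) i (hochschildFace μ L R n j f) := by
  funext a
  obtain ⟨b, rfl⟩ := exists_nat_extension a
  rcases Nat.eq_zero_or_pos i with rfl | hi
  · rcases Nat.eq_zero_or_pos j with rfl | hj0
    · simp [hochschildFace, hL]
    · rcases Nat.lt_or_ge n j with hjn | hjn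
      · simp [hochschildFace, hLR, show ¬ j ≤ n by omega, hj0.ne']
      · simp [hochschildFace, hjn, hj0.ne', hj0]
  · have hj0 : j ≠ 0 := by omega
    rcases Nat.lt_or_ge n j with hjn | hjn
    · obtain rfl : j = n + 1 := by omega
      rcases Nat.lt_or_ge n i with hin | hin
      · obtain rfl : i = n + 1 := by omega
        simp [hochschildFace, hR]
      · simp [hochschildFace, hin, hi.ne', show i ≤ n + 1 by omega]
        grind
    · simp only [hochschildFace, hi.ne', hj0, hjn, if_false, if_true, hij.trans hjn,
        show j + 1 ≠ 0 by omega, show j + 1 ≤ n + 1 by omega, show i ≤ n + 1 by omega]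
      congr 1
      funext p
      simp only [Fin.val_castSucc, Fin.val_succ]
      grind

theorem hochschildFace_zsmul_sum (n i : ℕ) (c : ℤ) {ι : Type*} (s : Finset ι) (e : ι → ℤ)
    (g : ι → (Fin n → A) → M) :
    hochschildFace μ L R n i (fun a => c • ∑ j ∈ s, e j • g j a) =
      fun a => c • ∑ j ∈ s, e j • hochschildFace μ L R n i (g j) a := by
  funext a
  unfold hochschildFace
  split_ifs <;> simp

theorem hochschildCoboundary_hochschildCoboundary
    (hμ : ∀ a b c, μ (μ a b) c = μ a (μ b c))
    (hL : ∀ a b m, L (μ a b) m = L a (L b m))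
    (hR : ∀ a b m, R (μ a b) m = R b (R a m))
    (hLR : ∀ a b m, R b (L a m) = L a (R b m))
    (n : ℕ) (f : (Fin n → A) → M) :
    hochschildCoboundary μ L R (n + 1) (hochschildCoboundary μ L R n f) = 0 := by
  funext a
  have key := sum_sum_alternating_eq_zero
    (fun j i => hochschildFace μ L R (n + 1) j (hochschildFace μ L R n i f) a) (n + 2)
    fun i j hij hj => congrFun (hochschildFace_hochschildFace μ L R hμ hL hR hLR n i j hij hj f) a
  unfold hochschildCoboundary
  simp_rw [hochschildFace_zsmul_sum, smul_comm _ ((-1 : ℤ) ^ (n + 1)), ← smul_sum]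
  simp_rw [pow_add, mul_smul, ← smul_sum] at key
  rw [key, smul_zero, smul_zero, Pi.zero_apply]

/-- A function of several variables is linear in each of them. -/
def IsSlotwiseLinear (k : Type*) {A M : Type*} [CommRing k] [AddCommGroup A] [Module k A]
    [AddCommGroup M] [Module k M] {n : ℕ} (f : (Fin n → A) → M) : Prop :=
  ∀ (a : Fin n → A) (i : Fin n), ∃ φ : A →ₗ[k] M, ∀ x, f (Function.update a i x) = φ x

theorem MultilinearMap.isSlotwiseLinear {n : ℕ} (f : MultilinearMap k (fun _ : Fin n => A) M) :
    IsSlotwiseLinear k f :=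
  fun a i => ⟨f.toLinearMap a i, fun _ => rfl⟩

theorem IsSlotwiseLinear.hochschildFace {n : ℕ} {f : (Fin n → A) → M}
    (hf : IsSlotwiseLinear k f) (i : ℕ) :
    IsSlotwiseLinear k (hochschildFace μ L R n i f) := by
  intro a s
  unfold _root_.hochschildFace
  split_ifs with h0 hn
  · induction s using Fin.cases with
    | zero => exact ⟨L.flip (f fun p => a p.succ), fun x => by simp⟩
    | succ s =>
      obtain ⟨φ, hφ⟩ := hf (fun p => a p.succ) s
      refine ⟨(L (a 0)).comp φ, fun x => ?_⟩
      rw [LinearMap.comp_apply, ← hφ]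
      congr 2
      funext p
      simp [Function.update_apply]
  · obtain ⟨t, ψ, h⟩ : ∃ (t : Fin n) (ψ : A →ₗ[k] A), ∀ x, (fun p : Fin n =>
        if (p : ℕ) + 1 < i then Function.update a s x p.castSucc
        else if (p : ℕ) + 1 = i then
          μ (Function.update a s x p.castSucc) (Function.update a s x p.succ)
        else Function.update a s x p.succ) =
        Function.update (fun p : Fin n =>
          if (p : ℕ) + 1 < i then a p.castSucc
          else if (p : ℕ) + 1 = i then μ (a p.castSucc) (a p.succ)
          else a p.succ) t (ψ x) := by
      rcases lt_trichotomy ((s : ℕ) + 1) i with hs | hs | hs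
      · refine ⟨⟨s, by omega⟩, LinearMap.id, fun x => ?_⟩
        funext p
        simp only [Function.update_apply, Fin.ext_iff, Fin.val_castSucc, Fin.val_succ,
          LinearMap.id_apply]
        grind
      · refine ⟨⟨s, by omega⟩, μ.flip (a ⟨s + 1, by omega⟩), fun x => ?_⟩
        funext p
        simp only [Function.update_apply, Fin.ext_iff, Fin.val_castSucc, Fin.val_succ,
          LinearMap.flip_apply]
        grind
      · by_cases hs' : (s : ℕ) = i
        · obtain ⟨b, rfl⟩ := exists_nat_extension a
          refine ⟨⟨s - 1, by omega⟩, μ (b (s - 1)), fun x => ?_⟩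
          funext p
          simp only [Function.update_apply, Fin.ext_iff, Fin.val_castSucc, Fin.val_succ]
          grind
        · refine ⟨⟨s - 1, by omega⟩, LinearMap.id, fun x => ?_⟩
          funext p
          simp only [Function.update_apply, Fin.ext_iff, Fin.val_castSucc, Fin.val_succ,
            LinearMap.id_apply]
          grind
    obtain ⟨φ, hφ⟩ := hf (fun p : Fin n =>
          if (p : ℕ) + 1 < i then a p.castSucc
          else if (p : ℕ) + 1 = i then μ (a p.castSucc) (a p.succ)
          else a p.succ) t
    exact ⟨φ.comp ψ, fun x => by rw [h, hφ, LinearMap.comp_apply]⟩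
  · induction s using Fin.lastCases with
    | last =>
      exact ⟨R.flip (f fun p => a p.castSucc), fun x => by
        simp [(Fin.castSucc_lt_last _).ne]⟩
    | cast s =>
      obtain ⟨φ, hφ⟩ := hf (fun p => a p.castSucc) s
      refine ⟨(R (a (Fin.last n))).comp φ, fun x => ?_⟩
      rw [LinearMap.comp_apply, ← hφ,
        Function.update_of_ne (Fin.castSucc_lt_last s).ne']
      congr 2
      funext p
      simp [Function.update_apply]

theorem IsSlotwiseLinear.hochschildCoboundary {n : ℕ} {f : (Fin n → A) → M}
    (hf : IsSlotwiseLinear k f) :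
    IsSlotwiseLinear k (hochschildCoboundary μ L R n f) := by
  intro a s
  choose φ hφ using fun i => hf.hochschildFace μ L R i a s
  exact ⟨((-1 : ℤ) ^ (n + 1)) • ∑ i ∈ range (n + 2), ((-1 : ℤ) ^ i) • φ i, fun x => by
    simp [_root_.hochschildCoboundary, hφ]⟩

end Hochschild

section RotaBaxter

variable {k A M : Type*} [Field k] [NonUnitalRing A] [Module k A]
  [AddCommGroup M] [Module k M]

/-- The action `T(a) m - T_M(a m)` induced on a Rota-Baxter module by an action `l`. -/
def rotaBaxterAction (T : A →ₗ[k] A) (TM : M →ₗ[k] M) (l : A →ₗ[k] M →ₗ[k] M) :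
    A →ₗ[k] M →ₗ[k] M :=
  l.comp T - l.compr₂ TM

theorem rotaBaxterAction_apply (T : A →ₗ[k] A) (TM : M →ₗ[k] M) (l : A →ₗ[k] M →ₗ[k] M)
    (a : A) (m : M) : rotaBaxterAction T TM l a m = l (T a) m - TM (l a m) := by
  simp [rotaBaxterAction]

variable [SMulCommClass k A A] [IsScalarTower k A A]

/-- The product `a ⋆ b = a T(b) + T(a) b + λ a b` induced by a Rota-Baxter operator. -/
def rotaBaxterStar (lam : k) (T : A →ₗ[k] A) : A →ₗ[k] A →ₗ[k] A :=
  (LinearMap.mul k A).compl₂ T + (LinearMap.mul k A).comp T + lam • LinearMap.mul k A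

theorem rotaBaxterStar_apply (lam : k) (T : A →ₗ[k] A) (a b : A) :
    rotaBaxterStar lam T a b = a * T b + T a * b + lam • (a * b) := by
  simp [rotaBaxterStar]

theorem rboCoboundary_eq_hochschildCoboundary (lam : k) (T : A →ₗ[k] A) (TM : M →ₗ[k] M)
    (l r : A →ₗ[k] M →ₗ[k] M) {n : ℕ} {f : (Fin n → A) → M} (hf : IsSlotwiseLinear k f) :
    rboCoboundary (fun a m => l a m) (fun m a => r a m) T TM lam n f =
      hochschildCoboundary (rotaBaxterStar lam T) (rotaBaxterAction T TM l)
        (rotaBaxterAction T TM r) n f := by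
  funext a
  have hterm : ∀ i : Fin n, ∃ φ : A →ₗ[k] M, ∀ op : A → A → A, f (fun j =>
      if (j : ℕ) < (i : ℕ) then a j.castSucc
      else if (j : ℕ) = (i : ℕ) then op (a j.castSucc) (a j.succ)
      else a j.succ) = φ (op (a i.castSucc) (a i.succ)) := by
    intro i
    obtain ⟨φ, hφ⟩ := hf (fun j => if (j : ℕ) < (i : ℕ) then a j.castSucc else a j.succ) i
    refine ⟨φ, fun op => ?_⟩
    rw [← hφ]
    congr 1
    funext j
    rcases eq_or_ne j i with rfl | hji
    · simp
    · simp [Function.update_of_ne hji, Fin.val_ne_of_ne hji]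
  unfold rboCoboundary hochschildCoboundary
  rw [sum_range_succ, sum_range_succ', sum_range, smul_add, smul_add, smul_sum,
    add_comm (∑ _, _)]
  congr 1
  · congr 1
    · simp [hochschildFace, rotaBaxterAction_apply]
    · refine sum_congr rfl fun i _ => ?_
      obtain ⟨φ, hφ⟩ := hterm i
      rw [hφ fun x y => x * T y, hφ fun x y => T x * y, hφ fun x y => x * y, smul_smul]
      have hsign : (-1 : ℤ) ^ (n + 1) * (-1) ^ ((i : ℕ) + 1) = (-1) ^ (n - (i : ℕ)) := by
        obtain ⟨d, hd⟩ := Nat.exists_eq_add_of_le i.2.le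
        rw [show n - (i : ℕ) = d by omega, ← pow_add,
          show n + 1 + ((i : ℕ) + 1) = d + 2 * (i + 1) by omega, pow_add, pow_mul]
        simp
      rw [hsign]
      congr 1
      have := hφ fun x y => rotaBaxterStar lam T x y
      simp only [hochschildFace, Nat.add_right_cancel_iff, Nat.add_lt_add_iff_right,
        Nat.succ_ne_zero, if_false, Nat.succ_le_iff.2 i.2, if_true]
      rw [this, rotaBaxterStar_apply, map_add, map_add, map_smul]
  · rw [smul_smul, ← pow_add, (Even.add_self (n + 1)).neg_one_pow, one_smul]
    simp [hochschildFace, rotaBaxterAction_apply]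

end RotaBaxter

/-- `∂` is a differential: `∂^{n+1} ∘ ∂ⁿ = 0` on `k`-multilinear cochains, so
`(C•_RBO(A,M), ∂)` is a cochain complex — the cochain complex of the Rota-Baxter
operator `T` with coefficients in `(M, T_M)`. -/
theorem rboCoboundary_squared_eq_zero {k A M : Type*} [Field k] [CharZero k]
    [NonUnitalRing A] [Module k A] [SMulCommClass k A A] [IsScalarTower k A A]
    [AddCommGroup M] [Module k M]
    (lam : k) (T : A →ₗ[k] A)
    (hT : ∀ a b : A, T a * T b = T (a * T b + T a * b + lam • (a * b)))
    (l r : A →ₗ[k] M →ₗ[k] M)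
    (hl : ∀ (a b : A) (m : M), l (a * b) m = l a (l b m))
    (hr : ∀ (a b : A) (m : M), r (a * b) m = r b (r a m))
    (hlr : ∀ (a b : A) (m : M), r b (l a m) = l a (r b m))
    (TM : M →ₗ[k] M)
    (hTM1 : ∀ (a : A) (m : M), l (T a) (TM m) = TM (l a (TM m) + l (T a) m + lam • l a m))
    (hTM2 : ∀ (a : A) (m : M), r (T a) (TM m) = TM (r (T a) m + r a (TM m) + lam • r a m)) :
    ∀ (n : ℕ) (f : MultilinearMap k (fun _ : Fin n => A) M),
      rboCoboundary (fun a m => l a m) (fun m a => r a m) (⇑T) (⇑TM) lam (n + 1)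
          (rboCoboundary (fun a m => l a m) (fun m a => r a m) (⇑T) (⇑TM) lam n ⇑f)
        = 0 := by
  intro n f
  have hf := f.isSlotwiseLinear
  rw [rboCoboundary_eq_hochschildCoboundary lam T TM l r hf,
    rboCoboundary_eq_hochschildCoboundary lam T TM l r (hf.hochschildCoboundary _ _ _)]
  have hTs : ∀ a b, T (rotaBaxterStar lam T a b) = T a * T b := fun a b => by
    rw [rotaBaxterStar_apply, hT]
  refine hochschildCoboundary_hochschildCoboundary _ _ _ ?_ ?_ ?_ ?_ n f
  · intro a b c
    rw [rotaBaxterStar_apply _ _ _ c, rotaBaxterStar_apply _ _ a (rotaBaxterStar lam T b c),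
      hTs, hTs]
    simp only [rotaBaxterStar_apply, mul_add, add_mul, smul_add, mul_smul_comm, smul_mul_assoc,
      mul_assoc]
    abel
  · intro a b m
    simp only [rotaBaxterAction_apply, hTs, map_sub, hTM1, hl]
    simp only [rotaBaxterStar_apply, map_add, map_smul, LinearMap.add_apply,
      LinearMap.smul_apply, hl]
    abel
  · intro a b m
    simp only [rotaBaxterAction_apply, hTs, map_sub, hTM2, hr]
    simp only [rotaBaxterStar_apply, map_add, map_smul, LinearMap.add_apply,
      LinearMap.smul_apply, hr]
    abel
  · intro a b m
    simp only [rotaBaxterAction_apply, map_sub, hTM1, hTM2, map_add, map_smul, hlr]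
    abel
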